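/- Let λ > 0, 0 < δ < 1, s > 0, L > 0, let t, d, n be positive natural numbers, let Zᵃ, Y ∈ ℝ^{t×d}, W, H ∈ ℝ^{t×n}, and Θ⋆ ∈ ℝ^{d×n} with ‖Θ⋆‖_F ≤ s. Set Z̄ = Zᵃ + Y, X̄ = Zᵃ·Θ⋆ + W + H, V̄ = Z̄ᵀZ̄ + λ·I, and Θ̂ = V̄⁻¹ Z̄ᵀ X̄. Assume the self-normalized bound Tr((Z̄ᵀW)ᵀ V̄⁻¹ (Z̄ᵀW)) ≤ 2 n² L² · log( det(V̄)^{1/2} · det(λI)^{-1/2} / δ ). Then Tr((Θ̂ − Θ⋆)ᵀ V̄ (Θ̂ − Θ⋆)) ≤ ( nL·√(2 log( det(V̄)^{1/2} det(λI)^{-1/2} / δ )) + λ^{-1/2}·‖Z̄ᵀH‖_F + (√λ + λ^{-1/2}·‖Z̄ᵀY‖_F)·s )². -/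

import Mathlib

open Matrix

/-- Frobenius norm of a real matrix: `‖A‖_F = √(Tr(AᵀA))`. -/
noncomputable def frobNorm {a b : ℕ} (A : Matrix (Fin a) (Fin b) ℝ) : ℝ :=
  Real.sqrt (Matrix.trace (Aᵀ * A))

lemma frobNorm_sq {a b : ℕ} (A : Matrix (Fin a) (Fin b) ℝ) :
    frobNorm A ^ 2 = trace (Aᵀ * A) := by
  refine Real.sq_sqrt ?_
  simpa using (posSemidef_conjTranspose_mul_self A).trace_nonneg

section Norm

open scoped Matrix.Norms.Frobenius

lemma frobNorm_eq_norm {a b : ℕ} (A : Matrix (Fin a) (Fin b) ℝ) : frobNorm A = ‖A‖ := by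
  rw [frobNorm, frobenius_norm_def, Real.sqrt_eq_rpow, trace, Finset.sum_comm]
  simp [mul_apply, sq]

lemma frobNorm_add_le {a b : ℕ} (A B : Matrix (Fin a) (Fin b) ℝ) :
    frobNorm (A + B) ≤ frobNorm A + frobNorm B := by
  simpa only [frobNorm_eq_norm] using norm_add_le A B

lemma frobNorm_sub_le {a b : ℕ} (A B : Matrix (Fin a) (Fin b) ℝ) :
    frobNorm (A - B) ≤ frobNorm A + frobNorm B := by
  simpa only [frobNorm_eq_norm] using norm_sub_le A B

lemma frobNorm_mul_le {a b c : ℕ} (A : Matrix (Fin a) (Fin b) ℝ) (B : Matrix (Fin b) (Fin c) ℝ) :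
    frobNorm (A * B) ≤ frobNorm A * frobNorm B := by
  simpa only [frobNorm_eq_norm] using frobenius_norm_mul A B

lemma frobNorm_smul {a b : ℕ} (r : ℝ) (A : Matrix (Fin a) (Fin b) ℝ) :
    frobNorm (r • A) = |r| * frobNorm A := by
  simp only [frobNorm_eq_norm, norm_smul, Real.norm_eq_abs]

end Norm

open scoped MatrixOrder Matrix.Norms.L2Operator in
lemma exists_eq_transpose_mul_self_of_posSemidef {d : ℕ} {A : Matrix (Fin d) (Fin d) ℝ}
    (hA : A.PosSemidef) : ∃ B : Matrix (Fin d) (Fin d) ℝ, A = Bᵀ * B := by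
  simpa [star_eq_conjTranspose] using CStarAlgebra.nonneg_iff_eq_star_mul_self.mp hA.nonneg

lemma posDef_transpose_mul_self_add_smul_one {t d : ℕ} (Z : Matrix (Fin t) (Fin d) ℝ) {lam : ℝ}
    (hlam : 0 < lam) : (Zᵀ * Z + lam • (1 : Matrix (Fin d) (Fin d) ℝ)).PosDef := by
  have h := posSemidef_conjTranspose_mul_self Z
  rw [conjTranspose_eq_transpose_of_trivial] at h
  exact PosDef.posSemidef_add h (PosDef.one.smul hlam)

lemma mul_trace_regularized_gram_le {t d n : ℕ} (Z : Matrix (Fin t) (Fin d) ℝ) {lam : ℝ}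
    (hlam : 0 < lam) (D : Matrix (Fin d) (Fin n) ℝ) :
    lam * trace (Dᵀ * (Zᵀ * Z + lam • (1 : Matrix (Fin d) (Fin d) ℝ)) * D) ≤
      frobNorm ((Zᵀ * Z + lam • (1 : Matrix (Fin d) (Fin d) ℝ)) * D) ^ 2 := by
  have hgram := frobNorm_sq (Zᵀ * Z * D)
  have hZD := frobNorm_sq (Z * D)
  rw [frobNorm_sq]
  have key : trace (((Zᵀ * Z + lam • (1 : Matrix (Fin d) (Fin d) ℝ)) * D)ᵀ *
        ((Zᵀ * Z + lam • (1 : Matrix (Fin d) (Fin d) ℝ)) * D)) =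
      lam * trace (Dᵀ * (Zᵀ * Z + lam • (1 : Matrix (Fin d) (Fin d) ℝ)) * D) +
        frobNorm (Zᵀ * Z * D) ^ 2 + lam * frobNorm (Z * D) ^ 2 := by
    rw [hgram, hZD]
    simp only [transpose_mul, transpose_add, transpose_smul, transpose_transpose,
      Matrix.add_mul, Matrix.mul_add, Matrix.smul_mul, Matrix.mul_smul, Matrix.one_mul,
      Matrix.mul_one, trace_add, trace_smul, smul_eq_mul, Matrix.mul_assoc]
    ring
  rw [key]
  nlinarith [sq_nonneg (frobNorm (Zᵀ * Z * D)),
    mul_nonneg hlam.le (sq_nonneg (frobNorm (Z * D)))]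

/-- Confidence set in the presence of a database attack (Theorem 1,
first part), conditionally on the self-normalized martingale bound: with
`Z̄ = Zᵃ + Y`, `X̄ = Zᵃ·Θ⋆ + W + H`, `V̄ = Z̄ᵀZ̄ + λI`, `Θ̂ = V̄⁻¹ Z̄ᵀ X̄`, and
assuming `Tr((Z̄ᵀW)ᵀ V̄⁻¹ (Z̄ᵀW)) ≤ 2n²L² log(det(V̄)^{1/2} det(λI)^{-1/2} / δ)`,
one has
`Tr((Θ̂−Θ⋆)ᵀ V̄ (Θ̂−Θ⋆)) ≤ (nL√(2 log(det(V̄)^{1/2} det(λI)^{-1/2}/δ))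
  + λ^{-1/2}‖Z̄ᵀH‖_F + (√λ + λ^{-1/2}‖Z̄ᵀY‖_F)·s)²`. -/
theorem stmt_2 {t d n : ℕ} (ht : 0 < t) (hd : 0 < d) (hn : 0 < n)
    (lam δ s L : ℝ) (hlam : 0 < lam) (hδ0 : 0 < δ) (hδ1 : δ < 1) (hs : 0 < s) (hL : 0 < L)
    (Za Y : Matrix (Fin t) (Fin d) ℝ) (W H : Matrix (Fin t) (Fin n) ℝ)
    (Θs : Matrix (Fin d) (Fin n) ℝ) (hΘs : frobNorm Θs ≤ s)
    (Zb : Matrix (Fin t) (Fin d) ℝ) (hZb : Zb = Za + Y)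
    (Xb : Matrix (Fin t) (Fin n) ℝ) (hXb : Xb = Za * Θs + W + H)
    (V : Matrix (Fin d) (Fin d) ℝ)
    (hV : V = Zbᵀ * Zb + lam • (1 : Matrix (Fin d) (Fin d) ℝ))
    (Θh : Matrix (Fin d) (Fin n) ℝ) (hΘh : Θh = V⁻¹ * Zbᵀ * Xb)
    (hSN : Matrix.trace ((Zbᵀ * W)ᵀ * V⁻¹ * (Zbᵀ * W)) ≤
      2 * (n : ℝ)^2 * L^2 *
        Real.log (Real.sqrt V.det /
          (Real.sqrt ((lam • (1 : Matrix (Fin d) (Fin d) ℝ)).det) * δ))) :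
    Matrix.trace ((Θh - Θs)ᵀ * V * (Θh - Θs)) ≤
      ((n : ℝ) * L *
          Real.sqrt (2 * Real.log (Real.sqrt V.det /
            (Real.sqrt ((lam • (1 : Matrix (Fin d) (Fin d) ℝ)).det) * δ))) +
        (1 / Real.sqrt lam) * frobNorm (Zbᵀ * H) +
        (Real.sqrt lam + (1 / Real.sqrt lam) * frobNorm (Zbᵀ * Y)) * s) ^ 2 := by
  have hVpd : V.PosDef := hV ▸ posDef_transpose_mul_self_add_smul_one Zb hlam
  have hdet : IsUnit V.det := hVpd.det_pos.ne'.isUnit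
  have hVT : Vᵀ = V := by simpa using hVpd.isHermitian.eq
  obtain ⟨B, hB⟩ : ∃ B : Matrix (Fin d) (Fin d) ℝ, V⁻¹ = Bᵀ * B :=
    exists_eq_transpose_mul_self_of_posSemidef hVpd.inv.posSemidef
  have hq (A : Matrix (Fin d) (Fin n) ℝ) : trace (Aᵀ * V⁻¹ * A) = frobNorm (B * A) ^ 2 := by
    rw [frobNorm_sq, hB, transpose_mul]
    simp only [Matrix.mul_assoc]
  have hq_mul (D : Matrix (Fin d) (Fin n) ℝ) :
      trace (Dᵀ * V * D) = frobNorm (B * (V * D)) ^ 2 := by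
    rw [← hq, transpose_mul, hVT, mul_nonsing_inv_cancel_right _ _ hdet, Matrix.mul_assoc]
  have hsqrt : 0 < Real.sqrt lam := Real.sqrt_pos.mpr hlam
  have hnn {a b : ℕ} (A : Matrix (Fin a) (Fin b) ℝ) : 0 ≤ frobNorm A := Real.sqrt_nonneg _
  have hq_le (A : Matrix (Fin d) (Fin n) ℝ) :
      frobNorm (B * A) ≤ 1 / Real.sqrt lam * frobNorm A := by
    have h := mul_trace_regularized_gram_le Zb hlam (V⁻¹ * A)
    rw [← hV, hq_mul, ← Matrix.mul_assoc V, mul_nonsing_inv _ hdet, Matrix.one_mul] at h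
    rw [one_div, ← div_eq_inv_mul, le_div_iff₀ hsqrt]
    refine le_of_sq_le_sq ?_ (hnn A)
    rw [mul_pow, Real.sq_sqrt hlam.le, mul_comm]
    exact h
  have herr : V * (Θh - Θs) = Zbᵀ * W + Zbᵀ * H - (lam • Θs + Zbᵀ * Y * Θs) := by
    have hZa : Za = Zb - Y := by rw [hZb, add_sub_cancel_right]
    rw [Matrix.mul_sub, hΘh, Matrix.mul_assoc V⁻¹, ← Matrix.mul_assoc V, mul_nonsing_inv _ hdet,
      Matrix.one_mul, hV, hXb, hZa]
    simp only [Matrix.mul_add, Matrix.add_mul, Matrix.mul_sub, Matrix.sub_mul, Matrix.smul_mul,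
      Matrix.one_mul, Matrix.mul_assoc]
    abel
  set ℓ := Real.log (Real.sqrt V.det /
    (Real.sqrt ((lam • (1 : Matrix (Fin d) (Fin d) ℝ)).det) * δ))
  have hnoise : frobNorm (B * (Zbᵀ * W)) ≤ n * L * Real.sqrt (2 * ℓ) := by
    rw [hq] at hSN
    calc frobNorm (B * (Zbᵀ * W)) ≤ Real.sqrt ((n * L) ^ 2 * (2 * ℓ)) :=
          Real.le_sqrt_of_sq_le (hSN.trans_eq (by ring))
      _ = n * L * Real.sqrt (2 * ℓ) := by
          rw [Real.sqrt_mul (sq_nonneg _), Real.sqrt_sq (by positivity)]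
  have hreg : frobNorm (B * (lam • Θs)) ≤ Real.sqrt lam * s := by
    refine (hq_le _).trans ?_
    rw [frobNorm_smul, abs_of_pos hlam, ← mul_assoc, one_div_mul_eq_div, Real.div_sqrt]
    gcongr
  have hattack : frobNorm (B * (Zbᵀ * Y * Θs)) ≤
      1 / Real.sqrt lam * frobNorm (Zbᵀ * Y) * s := by
    refine (hq_le _).trans ?_
    rw [mul_assoc]
    gcongr
    exact (frobNorm_mul_le _ _).trans (mul_le_mul_of_nonneg_left hΘs (hnn _))
  rw [hq_mul, herr, Matrix.mul_sub, Matrix.mul_add, Matrix.mul_add]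
  refine pow_le_pow_left₀ (hnn _) ?_ 2
  linarith [frobNorm_sub_le (B * (Zbᵀ * W) + B * (Zbᵀ * H))
      (B * (lam • Θs) + B * (Zbᵀ * Y * Θs)),
    frobNorm_add_le (B * (Zbᵀ * W)) (B * (Zbᵀ * H)),
    frobNorm_add_le (B * (lam • Θs)) (B * (Zbᵀ * Y * Θs)), hq_le (Zbᵀ * H)]
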